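/- arXiv:1109.5010 — 2 statements merged into one kernel-verified Lean document; each statement's English description precedes it below -/
import Mathlib

section
/- Let F : S¹ → ℂ be of bounded variation and let d ∈ ℕ. Then for any sequence Θ = (θ_k)_{k≥1} of strictly positive reals, (1/N^d)·𝔼_Θ[(tr(F)(σ))^d] = (∫_{S¹} F(φ) dφ)^d + O(𝔼_Θ[T(σ)]/N) as N → ∞, where dφ is the uniform probability measure on S¹, T(σ) is the total number of cycles of σ, and the implicit constant depends only on F and d (not on N or on Θ). In particular, the underlying deterministic estimate (1/N^d)·(tr(F)(σ))^d = (∫_{S¹} F dφ)^d + O_{F,d}(T(σ)/N) holds for every σ ∈ S_N. -/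
open scoped BigOperators
open Filter Asymptotics

/-- The number of cycles of length `k` of a permutation (fixed points count as
cycles of length 1). -/
noncomputable def cycleCount {N : ℕ} (σ : Equiv.Perm (Fin N)) (k : ℕ) : ℕ :=
  if k = 1 then N - σ.support.card else Multiset.count k σ.cycleType

/-- The total number of cycles of a permutation. -/
noncomputable def totalCycles {N : ℕ} (σ : Equiv.Perm (Fin N)) : ℕ :=
  ∑ k ∈ Finset.Icc 1 N, cycleCount σ k

/-- The permutation matrix `(δ_{i,σ(j)})` of a permutation, over ℂ. -/
noncomputable def permMatrixδ {N : ℕ} (σ : Equiv.Perm (Fin N)) : Matrix (Fin N) (Fin N) ℂ :=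
  Matrix.of fun i j => if i = σ j then 1 else 0

/-- `tr(F)(σ) = ∑_k F(ω_k)`: the sum of `F` over the eigenvalues (roots, with
multiplicity, of the characteristic polynomial) of the permutation matrix of `σ`. -/
noncomputable def trF {N : ℕ} (F : ℂ → ℂ) (σ : Equiv.Perm (Fin N)) : ℂ :=
  (((permMatrixδ σ).charpoly.roots).map F).sum

section RiemannSum

open MeasureTheory Set

/-- A function of bounded variation into `ℂ` is interval integrable. -/
lemma BoundedVariationOn.intervalIntegrable_complex {f : ℝ → ℂ} {a b : ℝ}
    (hf : BoundedVariationOn f (uIcc a b)) : IntervalIntegrable f volume a b := by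
  have real_case : ∀ g : ℝ → ℝ, BoundedVariationOn g (uIcc a b) →
      IntervalIntegrable g volume a b := by
    intro g hg
    obtain ⟨p, q, hp, hq, rfl⟩ :=
      hg.locallyBoundedVariationOn.exists_monotoneOn_sub_monotoneOn
    exact hp.intervalIntegrable.sub hq.intervalIntegrable
  have lipschitz_re : LipschitzWith 1 Complex.re := by
    refine LipschitzWith.of_dist_le_mul fun x y => ?_
    simpa [Complex.dist_eq, Real.dist_eq] using Complex.abs_re_le_norm (x - y)
  have lipschitz_im : LipschitzWith 1 Complex.im := by
    refine LipschitzWith.of_dist_le_mul fun x y => ?_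
    simpa [Complex.dist_eq, Real.dist_eq] using Complex.abs_im_le_norm (x - y)
  have hre := real_case _ (lipschitz_re.comp_boundedVariationOn hf)
  have him := real_case _ (lipschitz_im.comp_boundedVariationOn hf)
  have h : f = fun x => ((f x).re : ℂ) + ((f x).im : ℂ) * Complex.I :=
    funext fun x => (Complex.re_add_im _).symm
  rw [h]
  have hre' : IntervalIntegrable (fun x => ((f x).re : ℂ)) volume a b :=
    ⟨hre.1.ofReal, hre.2.ofReal⟩
  have him' : IntervalIntegrable (fun x => ((f x).im : ℂ)) volume a b :=
    ⟨him.1.ofReal, him.2.ofReal⟩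
  exact hre'.add (him'.mul_const _)

/-- Left Riemann sums of a function of bounded variation with `k` equal steps are within the total
variation of `k` times the integral. -/
lemma BoundedVariationOn.norm_sum_sub_mul_integral_le {f : ℝ → ℂ}
    (hf : BoundedVariationOn f (Icc 0 1)) {k : ℕ} (hk : 0 < k) :
    ‖∑ j ∈ Finset.range k, f (j / k) - k * ∫ x in (0 : ℝ)..1, f x‖
      ≤ (eVariationOn f (Icc 0 1)).toReal := by
  have hk' : (0 : ℝ) < k := by exact_mod_cast hk
  have hkc : (k : ℂ) ≠ 0 := by exact_mod_cast hk.ne'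
  set u : ℕ → ℝ := fun j => j / k with hu
  have hmono : Monotone u := fun i j hij => by
    simp only [hu]
    gcongr
  have hu0 : u 0 = 0 := by simp [hu]
  have huk : u k = 1 := by simp [hu, hk'.ne']
  have hsub : ∀ j < k, Icc (u j) (u (j + 1)) ⊆ Icc 0 1 := fun j hj =>
    Icc_subset_Icc (hu0 ▸ hmono (Nat.zero_le j)) (huk ▸ hmono hj)
  have hint : ∀ j < k, IntervalIntegrable f volume (u j) (u (j + 1)) := fun j hj => by
    apply BoundedVariationOn.intervalIntegrable_complex
    rw [uIcc_of_le (hmono (Nat.le_succ j))]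
    exact hf.mono (hsub j hj)
  have hstep : ∀ j, u (j + 1) - u j = 1 / k := fun j => by
    simp only [hu]
    push_cast
    ring
  have hsum := intervalIntegral.sum_integral_adjacent_intervals hint
  rw [hu0, huk] at hsum
  have hvar := eVariationOn.sum' f hmono (n := k)
  rw [hu0, huk] at hvar
  have hfin : ∀ j ∈ Finset.range k, eVariationOn f (Icc (u j) (u (j + 1))) ≠ ⊤ := fun j hj =>
    hf.mono (hsub j (Finset.mem_range.1 hj))
  rw [← hsum, ← hvar, ENNReal.toReal_sum hfin, Finset.mul_sum, ← Finset.sum_sub_distrib]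
  refine norm_sum_le_of_le _ fun j hj => ?_
  have hjk := Finset.mem_range.1 hj
  have hle : u j ≤ u (j + 1) := hmono (Nat.le_succ j)
  have hconst : f (u j) = k * ∫ _ in (u j)..(u (j + 1)), f (u j) := by
    rw [intervalIntegral.integral_const, hstep, Complex.real_smul]
    push_cast
    field_simp
  have hrw : f (j / k) - k * ∫ x in (u j)..(u (j + 1)), f x
      = k * ∫ x in (u j)..(u (j + 1)), (f (u j) - f x) := by
    rw [intervalIntegral.integral_sub (by simp) (hint j hjk), mul_sub, ← hconst]
  rw [hrw, norm_mul, Complex.norm_natCast]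
  have hbound := intervalIntegral.norm_integral_le_of_norm_le_const
    (f := fun x => f (u j) - f x) (a := u j) (b := u (j + 1))
    (C := (eVariationOn f (Icc (u j) (u (j + 1)))).toReal) (fun x hx => by
      rw [uIoc_of_le hle] at hx
      rw [← dist_eq_norm]
      exact BoundedVariationOn.dist_le (hfin j hj) (left_mem_Icc.2 hle) ⟨hx.1.le, hx.2⟩)
  rw [hstep, abs_of_pos (by positivity)] at hbound
  calc (k : ℝ) * ‖∫ x in (u j)..(u (j + 1)), (f (u j) - f x)‖
      ≤ k * ((eVariationOn f (Icc (u j) (u (j + 1)))).toReal * (1 / k)) := by gcongr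
    _ = _ := by field_simp

end RiemannSum

section CharacteristicPolynomial

open Equiv.Perm Polynomial

lemma matrix_of_perm_pow {β : Type*} [Fintype β] [DecidableEq β] (τ : Equiv.Perm β) (m : ℕ) :
    (Matrix.of fun i j => if i = τ j then (1 : ℂ) else 0) ^ m
      = Matrix.of fun i j => if i = (τ ^ m) j then (1 : ℂ) else 0 := by
  induction m with
  | zero => ext i j; simp [Matrix.one_apply]
  | succ m ih =>
    rw [pow_succ, ih]
    ext i j
    simp [Matrix.mul_apply, pow_succ]

/-- The characteristic polynomial of the matrix of a transitive permutation. -/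
lemma charpoly_matrix_of_isCycleOn {β : Type*} [Fintype β] [DecidableEq β] [Nonempty β]
    (τ : Equiv.Perm β) (hτ : τ.IsCycleOn (Finset.univ : Finset β)) :
    (Matrix.of fun i j => if i = τ j then (1 : ℂ) else 0).charpoly
      = X ^ Fintype.card β - C 1 := by
  set M : Matrix β β ℂ := Matrix.of fun i j => if i = τ j then (1 : ℂ) else 0 with hM
  set n := Fintype.card β
  have hn0 : 0 < n := Fintype.card_pos
  obtain ⟨x⟩ := ‹Nonempty β›
  have hdeg : (M.charpoly - (X ^ n - C 1)).degree < (n : WithBot ℕ) := by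
    have h := degree_sub_lt_left (p := M.charpoly) (q := X ^ n - C 1)
      (by rw [Matrix.charpoly_degree_eq_dim, degree_X_pow_sub_C hn0]) M.charpoly_monic.ne_zero
      (by rw [M.charpoly_monic.leadingCoeff, (monic_X_pow_sub_C _ hn0.ne').leadingCoeff])
    rwa [Matrix.charpoly_degree_eq_dim] at h
  have hpow : M ^ n = 1 := by
    have : τ ^ n = 1 := by
      ext y
      exact hτ.pow_card_apply (Finset.mem_univ y)
    rw [hM, matrix_of_perm_pow, this]
    ext i j
    by_cases h : i = j <;> simp [Matrix.one_apply, h]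
  have haeval : aeval M (M.charpoly - (X ^ n - C 1)) = 0 := by
    simp [Matrix.aeval_self_charpoly, hpow]
  refine sub_eq_zero.1 ?_
  generalize M.charpoly - (X ^ n - C 1) = q at hdeg haeval
  ext i
  rw [coeff_zero]
  by_cases hi : n ≤ i
  · exact coeff_eq_zero_of_degree_lt (hdeg.trans_le (by exact_mod_cast hi))
  push Not at hi
  have hnat : q.natDegree < n := by
    by_cases hq : q = 0
    · simpa [hq] using hn0
    · exact (natDegree_lt_iff_degree_lt hq).2 hdeg
  rw [aeval_eq_sum_range' hnat] at haeval
  have hentry := congrFun (congrFun haeval ((τ ^ i) x)) x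
  rw [Matrix.sum_apply, Finset.sum_eq_single i] at hentry
  · simpa [hM, matrix_of_perm_pow] using hentry
  · intro m hm hmi
    rw [hM, matrix_of_perm_pow]
    have : (τ ^ i) x ≠ (τ ^ m) x := by
      rw [Ne, hτ.pow_apply_eq_pow_apply (Finset.mem_univ x)]
      intro h
      exact hmi (Nat.ModEq.eq_of_lt_of_lt h.symm (Finset.mem_range.1 hm) hi)
    simp [this]
  · intro h
    exact absurd (Finset.mem_range.2 hi) h

/-- If the fibres of `b` are the cycles of `σ`, the characteristic polynomial of the permutation
matrix factors over the values of `b`. -/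
lemma charpoly_permMatrixδ {N : ℕ} (σ : Equiv.Perm (Fin N)) {ι : Type*} [LinearOrder ι]
    (b : Fin N → ι) (hb : ∀ x y, b x = b y ↔ σ.SameCycle x y) :
    (permMatrixδ σ).charpoly
      = ∏ a ∈ Finset.univ.image b, (X ^ (Finset.univ.filter fun x => b x = a).card - C 1) := by
  have hσ : ∀ x, b (σ x) = b x := fun x => (hb _ _).2 (sameCycle_apply_left.2 (SameCycle.refl _ _))
  have htri : (permMatrixδ σ).BlockTriangular b := by
    intro i j hij
    have : i ≠ σ j := by
      rintro rfl
      rw [hσ] at hij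
      exact lt_irrefl _ hij
    simp [permMatrixδ, this]
  rw [htri.charpoly]
  refine Finset.prod_congr rfl fun a ha => ?_
  obtain ⟨x, -, hx⟩ := Finset.mem_image.1 ha
  let τ : Equiv.Perm {y // b y = a} := σ.subtypePerm fun y => by rw [hσ]
  have : Nonempty {y // b y = a} := ⟨⟨x, hx⟩⟩
  have hτ : τ.IsCycleOn (Finset.univ : Finset {y // b y = a}) := by
    refine ⟨by simp [Set.bijOn_univ], fun y _ z _ => ?_⟩
    exact sameCycle_subtypePerm.2 ((hb _ _).1 (y.2.trans z.2.symm))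
  have hblock : (permMatrixδ σ).toSquareBlock b a
      = Matrix.of fun i j => if i = τ j then (1 : ℂ) else 0 := by
    ext i j
    simp [Matrix.toSquareBlock_def, permMatrixδ, τ, Subtype.ext_iff]
  rw [hblock, charpoly_matrix_of_isCycleOn τ hτ, Fintype.card_subtype]

lemma sum_map_roots_X_pow_sub_one (F : ℂ → ℂ) {k : ℕ} (hk : 0 < k) :
    (((X ^ k - C 1 : ℂ[X]).roots).map F).sum
      = ∑ j ∈ Finset.range k, F (Complex.exp (2 * Real.pi * Complex.I * ((j / k : ℝ) : ℂ))) := by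
  have h := (Complex.isPrimitiveRoot_exp k hk.ne').nthRoots_eq (one_pow k : (1 : ℂ) ^ k = 1)
  rw [nthRoots] at h
  rw [h, Multiset.map_map]
  change ∑ j ∈ Finset.range k, _ = _
  refine Finset.sum_congr rfl fun j _ => ?_
  simp only [Function.comp_apply, mul_one]
  rw [← Complex.exp_nat_mul]
  congr 2
  push_cast
  ring

end CharacteristicPolynomial

section CycleCounting

open Equiv.Perm

lemma totalCycles_eq {N : ℕ} (hN : 1 ≤ N) (σ : Equiv.Perm (Fin N)) :
    totalCycles σ = (N - σ.support.card) + σ.cycleType.card := by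
  have hIcc : Finset.Icc 1 N = insert 1 (Finset.Icc 2 N) := by
    ext k
    simp only [Finset.mem_Icc, Finset.mem_insert]
    omega
  rw [totalCycles, hIcc, Finset.sum_insert (by simp)]
  have h1 : cycleCount σ 1 = N - σ.support.card := by simp [cycleCount]
  have h2 : ∑ k ∈ Finset.Icc 2 N, cycleCount σ k
      = ∑ k ∈ Finset.Icc 2 N, Multiset.count k σ.cycleType := by
    refine Finset.sum_congr rfl fun k hk => ?_
    have := (Finset.mem_Icc.1 hk).1
    rw [cycleCount, if_neg (by omega)]
  rw [h1, h2, Multiset.sum_count_eq_card]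
  intro k hk
  refine Finset.mem_Icc.2 ⟨two_le_of_mem_cycleType hk, ?_⟩
  exact (Multiset.le_sum_of_mem hk).trans (by simpa using sum_cycleType_le σ)

/-- If points of a common cycle share their `b`-value, `b` has at most as many values as `σ` has
cycles. -/
lemma card_image_le_totalCycles {N : ℕ} (hN : 1 ≤ N) (σ : Equiv.Perm (Fin N)) {ι : Type*}
    [DecidableEq ι] (b : Fin N → ι) (hb : ∀ x y, σ.SameCycle x y → b x = b y) :
    (Finset.univ.image b).card ≤ totalCycles σ := by
  have hsplit : (Finset.univ : Finset (Fin N)) = σ.supportᶜ ∪ σ.support := by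
    rw [Finset.union_comm, Finset.union_compl]
  rw [totalCycles_eq hN, hsplit, Finset.image_union]
  refine (Finset.card_union_le _ _).trans (add_le_add ?_ ?_)
  · refine Finset.card_image_le.trans ?_
    rw [Finset.card_compl, Fintype.card_fin]
  · rw [cycleType_def, Multiset.card_map]
    refine Finset.card_le_card_of_forall_subsingleton
      (fun a c => ∃ x ∈ σ.support, b x = a ∧ σ.cycleOf x = c) ?_ ?_
    · intro a ha
      obtain ⟨x, hx, rfl⟩ := Finset.mem_image.1 ha
      exact ⟨σ.cycleOf x, cycleOf_mem_cycleFactorsFinset_iff.2 hx, x, hx, rfl, rfl⟩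
    · rintro c - a ⟨-, x, hx, rfl, rfl⟩ a' ⟨-, y, hy, rfl, hxy⟩
      refine hb x y ?_
      have hy' : y ∈ (σ.cycleOf y).support := mem_support_cycleOf_iff.2 ⟨SameCycle.refl _ _, hy⟩
      rw [hxy] at hy'
      exact (mem_support_cycleOf_iff.1 hy').1

end CycleCounting

section TraceEstimate

/-- The trace differs from `N ∫ F` by at most the total variation for each cycle. -/
lemma norm_trF_sub_le (F : ℂ → ℂ)
    (hF : BoundedVariationOn
      (fun x : ℝ => F (Complex.exp (2 * Real.pi * Complex.I * x))) (Set.Icc 0 1))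
    {N : ℕ} (hN : 1 ≤ N) (σ : Equiv.Perm (Fin N)) :
    ∃ K : ℕ, K ≤ N ∧ K ≤ totalCycles σ ∧
      ‖trF F σ - N * ∫ x in (0 : ℝ)..1, F (Complex.exp (2 * Real.pi * Complex.I * x))‖
        ≤ K * (eVariationOn (fun x : ℝ => F (Complex.exp (2 * Real.pi * Complex.I * x)))
            (Set.Icc 0 1)).toReal := by
  classical
  let e := Fintype.equivFin (Quotient (Equiv.Perm.SameCycle.setoid σ))
  let b : Fin N → Fin (Fintype.card (Quotient (Equiv.Perm.SameCycle.setoid σ))) :=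
    fun x => e (Quotient.mk _ x)
  have hb : ∀ x y, b x = b y ↔ σ.SameCycle x y := fun x y =>
    e.injective.eq_iff.trans Quotient.eq
  refine ⟨(Finset.univ.image b).card, Finset.card_image_le.trans (by simp),
    card_image_le_totalCycles hN σ b fun x y => (hb x y).2, ?_⟩
  have hpos : ∀ a ∈ Finset.univ.image b, 0 < (Finset.univ.filter fun x => b x = a).card := by
    intro a ha
    obtain ⟨x, -, hx⟩ := Finset.mem_image.1 ha
    exact Finset.card_pos.2 ⟨x, by simpa using hx⟩
  have htr : trF F σ = ∑ a ∈ Finset.univ.image b,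
      ∑ j ∈ Finset.range (Finset.univ.filter fun x => b x = a).card,
        F (Complex.exp (2 * Real.pi * Complex.I *
          ((j / (Finset.univ.filter fun x => b x = a).card : ℝ) : ℂ))) := by
    rw [trF, charpoly_permMatrixδ σ b hb, Polynomial.roots_prod, Multiset.map_bind,
      Multiset.sum_bind]
    · exact Finset.sum_congr rfl fun a ha => sum_map_roots_X_pow_sub_one F (hpos a ha)
    · exact Finset.prod_ne_zero_iff.2 fun a ha => Polynomial.X_pow_sub_C_ne_zero (hpos a ha) 1
  have hcard : (N : ℂ) = ∑ a ∈ Finset.univ.image b,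
      ((Finset.univ.filter fun x => b x = a).card : ℂ) := by
    have h := Finset.card_eq_sum_card_image b Finset.univ
    rw [Finset.card_univ, Fintype.card_fin] at h
    exact_mod_cast h
  rw [htr, hcard, Finset.sum_mul, ← Finset.sum_sub_distrib, ← nsmul_eq_mul]
  refine norm_sum_le_of_le _ (fun a ha => ?_) |>.trans (Finset.sum_const _).le
  exact hF.norm_sum_sub_mul_integral_le (hpos a ha)

lemma norm_pow_sub_pow_le_of_norm_le {z w : ℂ} {B : ℝ} (hz : ‖z‖ ≤ B) (hw : ‖w‖ ≤ B) (d : ℕ) :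
    ‖z ^ d - w ^ d‖ ≤ d * B ^ (d - 1) * ‖z - w‖ := by
  have hB : 0 ≤ B := (norm_nonneg z).trans hz
  rw [← Commute.geom_sum₂_mul (Commute.all z w), norm_mul]
  gcongr
  refine (norm_sum_le_of_le _ (f := fun i => z ^ i * w ^ (d - 1 - i)) (n := fun _ => B ^ (d - 1))
    fun i hi => ?_).trans (by simp)
  have hi' := Finset.mem_range.1 hi
  rw [norm_mul, norm_pow, norm_pow]
  calc ‖z‖ ^ i * ‖w‖ ^ (d - 1 - i) ≤ B ^ i * B ^ (d - 1 - i) := by gcongr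
    _ = B ^ (d - 1) := by rw [← pow_add]; congr 1; omega

lemma exists_norm_trF_pow_sub_le (F : ℂ → ℂ)
    (hF : BoundedVariationOn
      (fun x : ℝ => F (Complex.exp (2 * Real.pi * Complex.I * x))) (Set.Icc 0 1)) (d : ℕ) :
    ∃ c : ℝ, 0 < c ∧ ∀ N : ℕ, 1 ≤ N → ∀ σ : Equiv.Perm (Fin N),
      ‖trF F σ ^ d / (N : ℂ) ^ d
          - (∫ x in (0 : ℝ)..1, F (Complex.exp (2 * Real.pi * Complex.I * x))) ^ d‖
        ≤ c * totalCycles σ / N := by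
  set J := ∫ x in (0 : ℝ)..1, F (Complex.exp (2 * Real.pi * Complex.I * x))
  set V := (eVariationOn (fun x : ℝ => F (Complex.exp (2 * Real.pi * Complex.I * x)))
    (Set.Icc 0 1)).toReal
  have hV0 : 0 ≤ V := ENNReal.toReal_nonneg
  have hnn : 0 ≤ d * (‖J‖ + V) ^ (d - 1) * V := by positivity
  refine ⟨d * (‖J‖ + V) ^ (d - 1) * V + 1, by positivity, fun N hN σ => ?_⟩
  have hN' : (0 : ℝ) < N := by exact_mod_cast hN
  have hNc : (N : ℂ) ≠ 0 := Nat.cast_ne_zero.2 (by omega)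
  obtain ⟨K, hKN, hKT, hK⟩ := norm_trF_sub_le F hF hN σ
  have hdiff : ‖trF F σ / N - J‖ ≤ K * V / N := by
    have : trF F σ / N - J = (trF F σ - N * J) / N := by field_simp
    rw [this, norm_div, Complex.norm_natCast]
    gcongr
  have hdiffV : ‖trF F σ / N - J‖ ≤ V := by
    refine hdiff.trans ((div_le_iff₀ hN').2 ?_)
    rw [mul_comm]
    gcongr
  have hz : ‖trF F σ / N‖ ≤ ‖J‖ + V := by
    have := norm_add_le J (trF F σ / N - J)
    rw [add_sub_cancel] at this
    linarith
  rw [← div_pow]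
  calc ‖(trF F σ / N) ^ d - J ^ d‖
      ≤ d * (‖J‖ + V) ^ (d - 1) * ‖trF F σ / N - J‖ :=
        norm_pow_sub_pow_le_of_norm_le hz (by linarith) d
    _ ≤ d * (‖J‖ + V) ^ (d - 1) * (totalCycles σ * V / N) := by
        gcongr
        refine hdiff.trans ?_
        gcongr
    _ = d * (‖J‖ + V) ^ (d - 1) * V * totalCycles σ / N := by ring
    _ ≤ _ := by
        gcongr
        linarith

/-- A weighted average of quantities close to `m` is close to `m`. -/
lemma norm_weighted_average_sub_le {ι : Type*} (s : Finset ι) (w t : ι → ℝ) (X : ι → ℂ) (m : ℂ)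
    (hw : ∀ i ∈ s, 0 ≤ w i) (hpos : 0 < ∑ i ∈ s, w i) (h : ∀ i ∈ s, ‖X i - m‖ ≤ t i) :
    ‖(∑ i ∈ s, (w i : ℂ) * X i) / ((∑ i ∈ s, w i : ℝ) : ℂ) - m‖
      ≤ (∑ i ∈ s, w i * t i) / ∑ i ∈ s, w i := by
  have hne : ((∑ i ∈ s, w i : ℝ) : ℂ) ≠ 0 := by exact_mod_cast hpos.ne'
  have hrw : (∑ i ∈ s, (w i : ℂ) * X i) / ((∑ i ∈ s, w i : ℝ) : ℂ) - m
      = (∑ i ∈ s, (w i : ℂ) * (X i - m)) / ((∑ i ∈ s, w i : ℝ) : ℂ) := by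
    rw [eq_div_iff hne, sub_mul, div_mul_cancel₀ _ hne]
    push_cast
    simp only [mul_sub, Finset.sum_sub_distrib, ← Finset.sum_mul]
    ring
  rw [hrw, norm_div, Complex.norm_real, Real.norm_of_nonneg hpos.le]
  gcongr
  refine norm_sum_le_of_le _ fun i hi => ?_
  rw [norm_mul, Complex.norm_real, Real.norm_of_nonneg (hw i hi)]
  exact mul_le_mul_of_nonneg_left (h i hi) (hw i hi)

end TraceEstimate

/-- For `F` of bounded variation on the unit circle and `d ∈ ℕ`, the deterministic
estimate `(1/N^d)(tr(F)(σ))^d = (∫_{S¹}F dφ)^d + O_{F,d}(T(σ)/N)` holds for every `σ`,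
and consequently `(1/N^d)𝔼_Θ[(tr F)^d] = (∫_{S¹}F dφ)^d + O(𝔼_Θ[T]/N)` for every
generalized Ewens measure, with an implied constant independent of `N` and of `Θ`. -/
theorem moments_of_trace_bounded_variation (F : ℂ → ℂ)
    (hF : BoundedVariationOn
      (fun x : ℝ => F (Complex.exp (2 * Real.pi * Complex.I * x))) (Set.Icc 0 1))
    (d : ℕ) :
    ∃ c : ℝ, 0 < c ∧
      (∀ N : ℕ, 1 ≤ N → ∀ σ : Equiv.Perm (Fin N),
        ‖trF F σ ^ d / (N : ℂ) ^ d
            - (∫ x in (0 : ℝ)..1, F (Complex.exp (2 * Real.pi * Complex.I * x))) ^ d‖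
          ≤ c * totalCycles σ / N) ∧
      (∀ θ : ℕ → ℝ, (∀ k, 1 ≤ k → 0 < θ k) → ∀ N : ℕ, 1 ≤ N →
        ‖(∑ σ : Equiv.Perm (Fin N),
              ((∏ k ∈ Finset.Icc 1 N, θ k ^ cycleCount σ k : ℝ) : ℂ) * trF F σ ^ d)
            / ((∑ σ : Equiv.Perm (Fin N), ∏ k ∈ Finset.Icc 1 N, θ k ^ cycleCount σ k : ℝ) : ℂ)
            / (N : ℂ) ^ d
            - (∫ x in (0 : ℝ)..1, F (Complex.exp (2 * Real.pi * Complex.I * x))) ^ d‖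
          ≤ c * ((∑ σ : Equiv.Perm (Fin N),
                (∏ k ∈ Finset.Icc 1 N, θ k ^ cycleCount σ k) * totalCycles σ)
              / (∑ σ : Equiv.Perm (Fin N), ∏ k ∈ Finset.Icc 1 N, θ k ^ cycleCount σ k))
            / N) := by
  obtain ⟨c, hc, h⟩ := exists_norm_trF_pow_sub_le F hF d
  refine ⟨c, hc, h, fun θ hθ N hN => ?_⟩
  have hw : ∀ σ : Equiv.Perm (Fin N), 0 < ∏ k ∈ Finset.Icc 1 N, θ k ^ cycleCount σ k := fun σ =>
    Finset.prod_pos fun k hk => pow_pos (hθ k (Finset.mem_Icc.1 hk).1) _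
  have havg := norm_weighted_average_sub_le Finset.univ
    (fun σ : Equiv.Perm (Fin N) => ∏ k ∈ Finset.Icc 1 N, θ k ^ cycleCount σ k)
    (fun σ => c * totalCycles σ / N) (fun σ => trF F σ ^ d / (N : ℂ) ^ d) _
    (fun σ _ => (hw σ).le) (Finset.sum_pos (fun σ _ => hw σ) Finset.univ_nonempty)
    (fun σ _ => h N hN σ)
  convert havg using 1
  · congr 2
    rw [div_right_comm, Finset.sum_div]
    simp only [mul_div_assoc]
  · rw [← mul_div_assoc, div_right_comm, Finset.mul_sum, Finset.sum_div]
    congr 1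
    refine Finset.sum_congr rfl fun σ _ => ?_
    ring
end

section
/- Let F : S¹ → ℂ be continuous with Fourier coefficients c_m(F) := (1/2π)∫_0^{2π} e^{−imx} F(e^{ix}) dx, and assume c_0(F) = 0. If for some δ ∈ (0,1] one has c_m(F) = O(|m|^{−1−δ}) as |m| → ∞, then sup_{x∈[0,2π)} |Δ_k(F, e^{ix})| = O(k^{−1−δ}) as k → ∞; in particular, for any sequence (Z_k)_{k≥1} of S¹-valued random variables, 𝔼[|Δ_k(F,Z_k)|] = O(k^{−1−δ}). -/
open scoped BigOperators
open Filter Asymptotics MeasureTheory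

/-- `Δ_k(F,y) = (1/k) ∑_{ω^k = y} F(ω)`, the average of `F` over the `k`-th roots of
`y ≠ 0`, parameterized as `exp((log y + 2πim)/k)` for `m = 0,…,k−1`. -/
noncomputable def Δroot (F : ℂ → ℂ) (k : ℕ) (y : ℂ) : ℂ :=
  (k : ℂ)⁻¹ * ∑ m ∈ Finset.range k,
    F (Complex.exp ((Complex.log y + 2 * Real.pi * Complex.I * m) / k))

/-- The `m`-th Fourier coefficient `c_m(F) = (1/2π)∫_0^{2π} e^{−imx} F(e^{ix}) dx`. -/
noncomputable def fourierCoeffF (F : ℂ → ℂ) (m : ℤ) : ℂ :=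
  (2 * Real.pi : ℂ)⁻¹ *
    ∫ x in (0 : ℝ)..(2 * Real.pi),
      Complex.exp (-Complex.I * m * x) * F (Complex.exp (Complex.I * x))

open Complex in
lemma exists_fourierCoeff_eq_fourierCoeffF [Fact (0 < 2 * Real.pi)] {F : ℂ → ℂ}
    (hF : ContinuousOn F (Metric.sphere (0 : ℂ) 1)) :
    ∃ g : C(AddCircle (2 * Real.pi), ℂ), (∀ x : ℝ, g x = F (exp (I * x))) ∧
      ∀ m, fourierCoeff g m = fourierCoeffF F m := by
  have hg : ∀ x : ℝ, F (AddCircle.toCircle (x : AddCircle (2 * Real.pi))) = F (exp (I * x)) := by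
    intro x
    rw [AddCircle.toCircle_apply_mk, Circle.coe_exp, div_self (by positivity), one_mul, mul_comm]
  have hcont : Continuous fun x : AddCircle (2 * Real.pi) => F (AddCircle.toCircle x) :=
    hF.comp_continuous (continuous_subtype_val.comp AddCircle.continuous_toCircle)
      fun x => mem_sphere_zero_iff_norm.2 (Circle.norm_coe _)
  refine ⟨⟨_, hcont⟩, hg, fun m => ?_⟩
  rw [fourierCoeff_eq_intervalIntegral _ _ 0, fourierCoeffF, zero_add, Complex.real_smul]
  congr 1
  · push_cast
    rw [one_div]
  · refine intervalIntegral.integral_congr fun x _ => ?_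
    simp only [ContinuousMap.coe_mk, hg, fourier_coe_apply, smul_eq_mul]
    congr 2
    push_cast
    field_simp

open Complex in
/-- A continuous function on the unit circle with summable Fourier coefficients is the pointwise
sum of its Fourier series. -/
lemma hasSum_fourierCoeffF {F : ℂ → ℂ} (hF : ContinuousOn F (Metric.sphere (0 : ℂ) 1))
    (hs : Summable (fourierCoeffF F)) (x : ℝ) :
    HasSum (fun m : ℤ => fourierCoeffF F m * exp (I * x) ^ m) (F (exp (I * x))) := by
  have : Fact (0 < 2 * Real.pi) := ⟨Real.two_pi_pos⟩
  obtain ⟨g, hg, hc⟩ := exists_fourierCoeff_eq_fourierCoeffF hF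
  have h := has_pointwise_sum_fourier_series_of_summable (f := g)
    (by rwa [funext hc]) (x : AddCircle (2 * Real.pi))
  rw [hg] at h
  refine h.congr_fun ?_
  intro m
  rw [hc, fourier_coe_apply, smul_eq_mul, ← exp_int_mul]
  congr 2
  push_cast
  field_simp

open Complex in
/-- The `k`-th roots averaged by `Δroot` form a coset of the `k`-th roots of unity, so the average
of `ω ↦ ω ^ m` vanishes unless `k ∣ m`. -/
lemma Δroot_zpow_eq_zero {k : ℕ} (hk : k ≠ 0) (y : ℂ) {m : ℤ} (hm : ¬ (k : ℤ) ∣ m) :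
    Δroot (fun z => z ^ m) k y = 0 := by
  have hζ := Complex.isPrimitiveRoot_exp k hk
  set ζ := exp (2 * Real.pi * I / k)
  have hne : ζ ^ m ≠ 1 := fun h => hm ((hζ.zpow_eq_one_iff_dvd m).1 h)
  have hterm : ∀ j : ℕ, exp ((log y + 2 * Real.pi * I * j) / k) ^ m
      = exp (log y / k) ^ m * (ζ ^ m) ^ j := by
    intro j
    have : exp ((log y + 2 * Real.pi * I * j) / k) = exp (log y / k) * ζ ^ j := by
      rw [← exp_nat_mul, ← exp_add]
      congr 1
      ring
    rw [this, mul_zpow, ← zpow_natCast, ← zpow_natCast, zpow_comm]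
  have hgeom : ∑ j ∈ Finset.range k, (ζ ^ m) ^ j = 0 := by
    rw [geom_sum_eq hne, ← zpow_natCast, zpow_comm, zpow_natCast, hζ.pow_eq_one, one_zpow, sub_self,
      zero_div]
  simp only [Δroot, hterm, ← Finset.mul_sum, hgeom, mul_zero]

lemma norm_Δroot_le {F : ℂ → ℂ} {y : ℂ} {B : ℝ} (hB : 0 ≤ B) {k : ℕ}
    (h : ∀ j : ℕ, ‖F (Complex.exp ((Complex.log y + 2 * Real.pi * Complex.I * j) / k))‖ ≤ B) :
    ‖Δroot F k y‖ ≤ B := by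
  rcases eq_or_ne k 0 with rfl | hk
  · simpa [Δroot] using hB
  · rw [Δroot, norm_mul, norm_inv, Complex.norm_natCast, inv_mul_le_iff₀ (by positivity)]
    simpa using norm_sum_le_of_le (Finset.range k) fun j _ => h j

open Complex in
lemma exp_log_root_eq {y : ℂ} (hy : ‖y‖ = 1) (k j : ℕ) :
    exp ((log y + 2 * Real.pi * I * j) / k)
      = exp (I * ((arg y + 2 * Real.pi * j) / k : ℝ)) := by
  rw [Complex.log, hy, Real.log_one]
  push_cast
  congr 1
  ring

open Complex in
/-- Averaging over `k`-th roots retains only the Fourier modes divisible by `k`. -/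
lemma hasSum_Δroot {F : ℂ → ℂ} (hF : ContinuousOn F (Metric.sphere (0 : ℂ) 1))
    (hs : Summable (fourierCoeffF F)) {k : ℕ} (hk : k ≠ 0) {y : ℂ} (hy : ‖y‖ = 1) :
    HasSum (fun n : ℤ => fourierCoeffF F (k * n) * Δroot (fun z => z ^ (k * n : ℤ)) k y)
      (Δroot F k y) := by
  have hall : HasSum (fun m : ℤ => fourierCoeffF F m * Δroot (fun z => z ^ m) k y)
      (Δroot F k y) := by
    have h := (hasSum_sum (s := Finset.range k) fun j _ =>
      hasSum_fourierCoeffF hF hs ((arg y + 2 * Real.pi * j) / k)).mul_left (k : ℂ)⁻¹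
    simp only [← exp_log_root_eq hy, ← Finset.mul_sum] at h
    refine h.congr_fun fun m => ?_
    rw [Δroot, mul_left_comm]
  have hinj : Function.Injective fun n : ℤ => (k : ℤ) * n :=
    mul_right_injective₀ (by exact_mod_cast hk)
  refine (hinj.hasSum_iff fun m hm => ?_).2 hall
  rw [Δroot_zpow_eq_zero hk y fun ⟨n, hn⟩ => hm ⟨n, hn.symm⟩, mul_zero]

/-- Coefficients of size `|m| ^ (-1 - δ)` force `Δroot F k` to be of size `k ^ (-1 - δ)`. -/
lemma norm_Δroot_le_of_norm_fourierCoeffF_le {F : ℂ → ℂ}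
    (hF : ContinuousOn F (Metric.sphere (0 : ℂ) 1)) {δ C : ℝ} (hδ : 0 < δ)
    (hC : ∀ m : ℤ, ‖fourierCoeffF F m‖ ≤ C * |(m : ℝ)| ^ (-1 - δ))
    {k : ℕ} (hk : k ≠ 0) {y : ℂ} (hy : ‖y‖ = 1) :
    ‖Δroot F k y‖ ≤ C * (∑' n : ℤ, |(n : ℝ)| ^ (-1 - δ)) * (k : ℝ) ^ (-1 - δ) := by
  have hsum : Summable fun n : ℤ => |(n : ℝ)| ^ (-1 - δ) := by
    have := Real.summable_abs_int_rpow (b := 1 + δ) (by linarith)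
    simpa only [neg_add'] using this
  have hs : Summable (fourierCoeffF F) := .of_norm_bounded (hsum.mul_left C) hC
  have hbound := (hsum.hasSum.mul_left C).mul_right ((k : ℝ) ^ (-1 - δ))
  refine (hasSum_Δroot hF hs hk hy).norm_le_of_bounded hbound fun n => ?_
  have hone : ‖Δroot (fun z => z ^ (k * n : ℤ)) k y‖ ≤ 1 :=
    norm_Δroot_le zero_le_one fun j => by
      rw [exp_log_root_eq hy, norm_zpow, mul_comm Complex.I, Complex.norm_exp_ofReal_mul_I,
        one_zpow]
  calc _ ≤ ‖fourierCoeffF F (k * n)‖ := by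
        rw [norm_mul]
        exact mul_le_of_le_one_right (norm_nonneg _) hone
    _ ≤ C * |((k * n : ℤ) : ℝ)| ^ (-1 - δ) := hC _
    _ = C * |(n : ℝ)| ^ (-1 - δ) * (k : ℝ) ^ (-1 - δ) := by
        push_cast
        rw [abs_mul, Nat.abs_cast, Real.mul_rpow (by positivity) (by positivity)]
        ring

/-- If `F` is continuous on the unit circle, has vanishing mean value (`c₀(F) = 0`) and
Fourier coefficients `c_m(F) = O(|m|^{−1−δ})`, then `Δ_k(F,·)` is uniformly
`O(k^{−1−δ})` on the circle; in particular `𝔼[|Δ_k(F,Z_k)|] = O(k^{−1−δ})` for any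
circle-valued random variables `Z_k`. -/
theorem fourier_decay_gives_Delta_decay (F : ℂ → ℂ)
    (hF : ContinuousOn F (Metric.sphere (0 : ℂ) 1))
    (hc0 : fourierCoeffF F 0 = 0)
    (δ : ℝ) (hδ0 : 0 < δ) (hδ1 : δ ≤ 1)
    (hdecay : (fun m : ℤ => fourierCoeffF F m)
      =O[Filter.cofinite] fun m : ℤ => |(m : ℝ)| ^ (-1 - δ)) :
    (∃ C : ℝ, 0 < C ∧ ∀ k : ℕ, 1 ≤ k → ∀ x : ℝ, 0 ≤ x → x < 2 * Real.pi →
      ‖Δroot F k (Complex.exp (Complex.I * x))‖ ≤ C * (k : ℝ) ^ (-1 - δ))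
    ∧ ∀ (Ω : Type) [MeasurableSpace Ω] (μ : Measure Ω) [IsProbabilityMeasure μ]
        (Z : ℕ → Ω → ℂ), (∀ k ω, Z k ω ∈ Metric.sphere (0 : ℂ) 1) →
        (fun k : ℕ => ∫ ω, ‖Δroot F k (Z k ω)‖ ∂μ)
          =O[atTop] fun k : ℕ => (k : ℝ) ^ (-1 - δ) := by
  have hexp : -1 - δ ≠ 0 := by linarith
  obtain ⟨C, hC⟩ := (isBigO_cofinite_iff fun m hm => by
    have : m = 0 := by
      simpa using (Real.rpow_eq_zero (abs_nonneg (m : ℝ)) hexp).1 hm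
    rw [this, hc0]).1 hdecay
  have hC' : ∀ m : ℤ, ‖fourierCoeffF F m‖ ≤ C * |(m : ℝ)| ^ (-1 - δ) := fun m => by
    simpa only [Real.norm_of_nonneg (Real.rpow_nonneg (abs_nonneg (m : ℝ)) _)] using hC m
  set D := C * ∑' n : ℤ, |(n : ℝ)| ^ (-1 - δ)
  have hD : ∀ k : ℕ, k ≠ 0 → ∀ y : ℂ, ‖y‖ = 1 → ‖Δroot F k y‖ ≤ D * (k : ℝ) ^ (-1 - δ) :=
    fun k hk y hy => norm_Δroot_le_of_norm_fourierCoeffF_le hF hδ0 hC' hk hy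
  constructor
  · refine ⟨max D 1, by positivity, fun k hk x _ _ => ?_⟩
    refine (hD k (by omega) _ ?_).trans (by gcongr; exact le_max_left _ _)
    rw [mul_comm, Complex.norm_exp_ofReal_mul_I]
  · intro Ω _ μ _ Z hZ
    refine IsBigO.of_bound D ?_
    filter_upwards [eventually_ge_atTop 1] with k hk
    rw [Real.norm_of_nonneg (Real.rpow_nonneg k.cast_nonneg _)]
    refine (norm_integral_le_of_norm_le_const (μ := μ) (C := D * (k : ℝ) ^ (-1 - δ))
      (.of_forall fun ω => ?_)).trans (by simp)
    rw [norm_norm]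
    exact hD k (by omega) _ (by simpa using hZ k ω)
end
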